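/- A C² metric g - dz² on a planar domain is flat (has identically vanishing Gaussian curvature) if and only if z satisfies the Darboux equation det Hess_g z = K (det g)(1 - |∇_g z|²), provided 1 - |∇_g z|² > 0. Consequently, if z solves the Darboux equation with |∇z(0)| = 0 on a simply connected neighborhood of the origin, then there exist functions u, v with g - dz² = du² + dv², and the map (u, v, z) is a local isometric embedding of (Ω, g) into ℝ³. -/

import Mathlib

open Set

/-- Directional partial derivative `∂_i f` (`i = 0` is `∂_x`, `i = 1` is `∂_y`). -/
noncomputable def pdi (i : Fin 2) (f : ℝ × ℝ → ℝ) (q : ℝ × ℝ) : ℝ :=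
  fderiv ℝ f q (if i = 0 then (1, 0) else (0, 1))

/-- Christoffel symbols `Γ^k_{ij}` of a metric `g` on a planar domain. -/
noncomputable def christoffel (g : ℝ × ℝ → Matrix (Fin 2) (Fin 2) ℝ)
    (k i j : Fin 2) (q : ℝ × ℝ) : ℝ :=
  (1 / 2) * ∑ l : Fin 2, (g q)⁻¹ k l *
    (pdi i (fun p => g p j l) q + pdi j (fun p => g p i l) q - pdi l (fun p => g p i j) q)

/-- Covariant Hessian `∇_{ij} z` with respect to `g`. -/
noncomputable def covHess (g : ℝ × ℝ → Matrix (Fin 2) (Fin 2) ℝ)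
    (z : ℝ × ℝ → ℝ) (i j : Fin 2) (q : ℝ × ℝ) : ℝ :=
  pdi i (fun p => pdi j z p) q - ∑ k : Fin 2, christoffel g k i j q * pdi k z q

/-- Gaussian curvature `K = R_{1212} / det g` of a metric on a planar domain. -/
noncomputable def gaussCurv (g : ℝ × ℝ → Matrix (Fin 2) (Fin 2) ℝ) (q : ℝ × ℝ) : ℝ :=
  (∑ l : Fin 2, g q 0 l *
      (pdi 0 (fun p => christoffel g l 1 1 p) q - pdi 1 (fun p => christoffel g l 0 1 p) q
        + ∑ m : Fin 2, (christoffel g l 0 m q * christoffel g m 1 1 q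
            - christoffel g l 1 m q * christoffel g m 0 1 q))) / (g q).det

/-- `|∇_g z|² = g^{ij} ∂_i z ∂_j z`. -/
noncomputable def gradSq (g : ℝ × ℝ → Matrix (Fin 2) (Fin 2) ℝ)
    (z : ℝ × ℝ → ℝ) (q : ℝ × ℝ) : ℝ :=
  ∑ i : Fin 2, ∑ j : Fin 2, (g q)⁻¹ i j * pdi i z q * pdi j z q

/-- The metric `g - dz²`. -/
noncomputable def gmod (g : ℝ × ℝ → Matrix (Fin 2) (Fin 2) ℝ)
    (z : ℝ × ℝ → ℝ) (q : ℝ × ℝ) : Matrix (Fin 2) (Fin 2) ℝ :=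
  g q - Matrix.of fun i j => pdi i z q * pdi j z q

open Filter Topology

section PartialDerivatives

variable {f f₁ f₂ : ℝ × ℝ → ℝ} {U : Set (ℝ × ℝ)} {q : ℝ × ℝ}

lemma pdi_congr (i : Fin 2) (hU : IsOpen U) (hq : q ∈ U) (h : ∀ p ∈ U, f₁ p = f₂ p) :
    pdi i f₁ q = pdi i f₂ q := by
  have : f₁ =ᶠ[𝓝 q] f₂ := by filter_upwards [hU.mem_nhds hq] with p hp using h p hp
  simp only [pdi, this.fderiv_eq]

lemma pdi_add (i : Fin 2) (h₁ : DifferentiableAt ℝ f₁ q) (h₂ : DifferentiableAt ℝ f₂ q) :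
    pdi i (fun p => f₁ p + f₂ p) q = pdi i f₁ q + pdi i f₂ q := by
  simp only [pdi, fderiv_fun_add h₁ h₂, add_apply]

lemma pdi_sub (i : Fin 2) (h₁ : DifferentiableAt ℝ f₁ q) (h₂ : DifferentiableAt ℝ f₂ q) :
    pdi i (fun p => f₁ p - f₂ p) q = pdi i f₁ q - pdi i f₂ q := by
  simp only [pdi, fderiv_fun_sub h₁ h₂, sub_apply]

lemma pdi_mul (i : Fin 2) (h₁ : DifferentiableAt ℝ f₁ q) (h₂ : DifferentiableAt ℝ f₂ q) :
    pdi i (fun p => f₁ p * f₂ p) q = pdi i f₁ q * f₂ q + f₁ q * pdi i f₂ q := by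
  simp only [pdi, fderiv_fun_mul h₁ h₂, add_apply, smul_apply, smul_eq_mul]
  ring

lemma pdi_const_mul (i : Fin 2) (c : ℝ) (h : DifferentiableAt ℝ f q) :
    pdi i (fun p => c * f p) q = c * pdi i f q := by
  simp only [pdi, fderiv_const_mul h c, smul_apply, smul_eq_mul]

lemma ContDiffOn.pdi {n m : ℕ} (i : Fin 2) (hU : IsOpen U) (hf : ContDiffOn ℝ n f U)
    (hmn : m + 1 ≤ n) : ContDiffOn ℝ m (pdi i f) U :=
  (hf.fderiv_of_isOpen hU (by exact_mod_cast hmn)).clm_apply contDiffOn_const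

lemma ContDiffOn.differentiableAt_of_isOpen {n : ℕ} (hU : IsOpen U) (hf : ContDiffOn ℝ n f U)
    (hn : n ≠ 0) (hq : q ∈ U) : DifferentiableAt ℝ f q :=
  (hf.contDiffAt (hU.mem_nhds hq)).differentiableAt (by exact_mod_cast hn)

lemma pdi_comm (hU : IsOpen U) (hf : ContDiffOn ℝ 2 f U) (hq : q ∈ U) :
    pdi 1 (pdi 0 f) q = pdi 0 (pdi 1 f) q := by
  have hs : IsSymmSndFDerivAt ℝ f q :=
    (hf.contDiffAt (hU.mem_nhds hq)).isSymmSndFDerivAt (by simp)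
  have hd : DifferentiableAt ℝ (fderiv ℝ f) q :=
    ((hf.fderiv_of_isOpen (m := 1) hU (by norm_num)).contDiffAt
      (hU.mem_nhds hq)).differentiableAt (by norm_num)
  have key : ∀ v w : ℝ × ℝ,
      fderiv ℝ (fun p => fderiv ℝ f p v) q w = fderiv ℝ (fderiv ℝ f) q w v := by
    intro v w
    rw [fderiv_clm_apply hd (by fun_prop)]
    simp
  have := hs (0, 1) (1, 0)
  unfold pdi
  simp only [Fin.isValue, one_ne_zero, if_false, if_true]
  rw [key, key, this]

lemma pdi_pdi_add (i j : Fin 2) (hU : IsOpen U) (h₁ : ContDiffOn ℝ 2 f₁ U)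
    (h₂ : ContDiffOn ℝ 2 f₂ U) (hq : q ∈ U) :
    pdi i (pdi j fun p => f₁ p + f₂ p) q = pdi i (pdi j f₁) q + pdi i (pdi j f₂) q := by
  have d₁ := fun p hp => h₁.differentiableAt_of_isOpen (q := p) hU two_ne_zero hp
  have d₂ := fun p hp => h₂.differentiableAt_of_isOpen (q := p) hU two_ne_zero hp
  rw [pdi_congr i hU hq fun p hp => pdi_add j (d₁ p hp) (d₂ p hp),
    pdi_add i ((h₁.pdi (m := 1) j hU le_rfl).differentiableAt_of_isOpen hU one_ne_zero hq)
      ((h₂.pdi (m := 1) j hU le_rfl).differentiableAt_of_isOpen hU one_ne_zero hq)]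

lemma pdi_pdi_sub (i j : Fin 2) (hU : IsOpen U) (h₁ : ContDiffOn ℝ 2 f₁ U)
    (h₂ : ContDiffOn ℝ 2 f₂ U) (hq : q ∈ U) :
    pdi i (pdi j fun p => f₁ p - f₂ p) q = pdi i (pdi j f₁) q - pdi i (pdi j f₂) q := by
  have d₁ := fun p hp => h₁.differentiableAt_of_isOpen (q := p) hU two_ne_zero hp
  have d₂ := fun p hp => h₂.differentiableAt_of_isOpen (q := p) hU two_ne_zero hp
  rw [pdi_congr i hU hq fun p hp => pdi_sub j (d₁ p hp) (d₂ p hp),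
    pdi_sub i ((h₁.pdi (m := 1) j hU le_rfl).differentiableAt_of_isOpen hU one_ne_zero hq)
      ((h₂.pdi (m := 1) j hU le_rfl).differentiableAt_of_isOpen hU one_ne_zero hq)]

lemma pdi_pdi_mul (i j : Fin 2) (hU : IsOpen U) (h₁ : ContDiffOn ℝ 2 f₁ U)
    (h₂ : ContDiffOn ℝ 2 f₂ U) (hq : q ∈ U) :
    pdi i (pdi j fun p => f₁ p * f₂ p) q =
      pdi i (pdi j f₁) q * f₂ q + pdi j f₁ q * pdi i f₂ q + pdi i f₁ q * pdi j f₂ q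
        + f₁ q * pdi i (pdi j f₂) q := by
  have d₁ := fun p hp => h₁.differentiableAt_of_isOpen (q := p) hU two_ne_zero hp
  have d₂ := fun p hp => h₂.differentiableAt_of_isOpen (q := p) hU two_ne_zero hp
  have e₁ := (h₁.pdi (m := 1) j hU le_rfl).differentiableAt_of_isOpen hU one_ne_zero hq
  have e₂ := (h₂.pdi (m := 1) j hU le_rfl).differentiableAt_of_isOpen hU one_ne_zero hq
  rw [pdi_congr i hU hq fun p hp => pdi_mul j (d₁ p hp) (d₂ p hp),
    pdi_add i (e₁.fun_mul (d₂ q hq)) ((d₁ q hq).fun_mul e₂),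
    pdi_mul i e₁ (d₂ q hq), pdi_mul i (d₁ q hq) e₂]
  ring

lemma fderiv_eq_pdi (f : ℝ × ℝ → ℝ) (q v : ℝ × ℝ) :
    fderiv ℝ f q v = v.1 * pdi 0 f q + v.2 * pdi 1 f q := by
  have hv : v = v.1 • ((1 : ℝ), (0 : ℝ)) + v.2 • ((0 : ℝ), (1 : ℝ)) := by ext <;> simp
  conv_lhs => rw [hv, map_add, map_smul, map_smul]
  simp [pdi]

/-- Poincaré lemma for the `1`-form `P dx + Q dy` on a planar convex open set. -/
lemma exists_hasFDerivAt_of_pdi_eq {P Q : ℝ × ℝ → ℝ} (hc : Convex ℝ U) (hU : IsOpen U)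
    (hP : DifferentiableOn ℝ P U) (hQ : DifferentiableOn ℝ Q U)
    (h : ∀ q ∈ U, pdi 1 P q = pdi 0 Q q) :
    ∃ f : ℝ × ℝ → ℝ, ∀ q ∈ U, HasFDerivAt f
      (P q • ContinuousLinearMap.fst ℝ ℝ ℝ + Q q • ContinuousLinearMap.snd ℝ ℝ ℝ) q := by
  refine hc.exists_forall_hasFDerivAt_of_fderiv_symmetric hU (by fun_prop) fun q hq x y => ?_
  have dP := hP.differentiableAt (hU.mem_nhds hq)
  have dQ := hQ.differentiableAt (hU.mem_nhds hq)
  rw [((dP.hasFDerivAt.smul_const (ContinuousLinearMap.fst ℝ ℝ ℝ)).fun_add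
    (dQ.hasFDerivAt.smul_const (ContinuousLinearMap.snd ℝ ℝ ℝ))).fderiv]
  simp only [add_apply, ContinuousLinearMap.smulRight_apply, smul_apply, smul_eq_mul,
    ContinuousLinearMap.coe_fst', ContinuousLinearMap.coe_snd', fderiv_eq_pdi, h q hq]
  ring

lemma HasFDerivAt.pdi_zero {P Q : ℝ} (h : HasFDerivAt f
    (P • ContinuousLinearMap.fst ℝ ℝ ℝ + Q • ContinuousLinearMap.snd ℝ ℝ ℝ) q) :
    pdi 0 f q = P := by
  simp [pdi, h.fderiv]

lemma HasFDerivAt.pdi_one {P Q : ℝ} (h : HasFDerivAt f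
    (P • ContinuousLinearMap.fst ℝ ℝ ℝ + Q • ContinuousLinearMap.snd ℝ ℝ ℝ) q) :
    pdi 1 f q = Q := by
  simp [pdi, h.fderiv]

end PartialDerivatives

section Curvature

/-- The covariant curvature component `R_{1212}` of the metric `E dx² + 2 F dx dy + G dy²`,
written through Christoffel symbols of the first kind. -/
noncomputable def riemannLower (E F G : ℝ × ℝ → ℝ) (q : ℝ × ℝ) : ℝ :=
  pdi 0 (pdi 1 F) q - pdi 0 (pdi 0 G) q / 2 - pdi 1 (pdi 1 E) q / 2
    + (G q * (pdi 1 E q / 2) ^ 2 - 2 * F q * (pdi 1 E q / 2) * (pdi 0 G q / 2)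
        + E q * (pdi 0 G q / 2) ^ 2
        - (G q * (pdi 0 E q / 2) * (pdi 1 F q - pdi 0 G q / 2)
          - F q * ((pdi 0 E q / 2) * (pdi 1 G q / 2)
            + (pdi 0 F q - pdi 1 E q / 2) * (pdi 1 F q - pdi 0 G q / 2))
          + E q * (pdi 0 F q - pdi 1 E q / 2) * (pdi 1 G q / 2)))
      / (E q * G q - F q ^ 2)

variable {h : ℝ × ℝ → Matrix (Fin 2) (Fin 2) ℝ} {E F G : ℝ × ℝ → ℝ} {U : Set (ℝ × ℝ)}
  {q : ℝ × ℝ}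

lemma pdi_entries (hU : IsOpen U) (hh : ∀ p ∈ U, h p = !![E p, F p; F p, G p]) (hq : q ∈ U)
    (i : Fin 2) :
    pdi i (fun p => h p 0 0) q = pdi i E q ∧ pdi i (fun p => h p 0 1) q = pdi i F q ∧
    pdi i (fun p => h p 1 0) q = pdi i F q ∧ pdi i (fun p => h p 1 1) q = pdi i G q := by
  refine ⟨?_, ?_, ?_, ?_⟩ <;> exact pdi_congr i hU hq fun p hp => by simp [hh p hp]

lemma inv_entries (hh : h q = !![E q, F q; F q, G q]) :
    (h q)⁻¹ 0 0 = G q / (E q * G q - F q ^ 2) ∧ (h q)⁻¹ 0 1 = -F q / (E q * G q - F q ^ 2) ∧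
    (h q)⁻¹ 1 0 = -F q / (E q * G q - F q ^ 2) ∧ (h q)⁻¹ 1 1 = E q / (E q * G q - F q ^ 2) := by
  rw [Matrix.inv_def, hh, Matrix.adjugate_fin_two, Matrix.det_fin_two]
  refine ⟨?_, ?_, ?_, ?_⟩ <;> simp [sq, div_eq_inv_mul]

lemma christoffel_eq (hU : IsOpen U) (hh : ∀ p ∈ U, h p = !![E p, F p; F p, G p]) (hq : q ∈ U) :
    (christoffel h 0 0 0 q = (G q * (pdi 0 E q / 2) - F q * (pdi 0 F q - pdi 1 E q / 2))
        / (E q * G q - F q ^ 2) ∧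
      christoffel h 1 0 0 q = (E q * (pdi 0 F q - pdi 1 E q / 2) - F q * (pdi 0 E q / 2))
        / (E q * G q - F q ^ 2)) ∧
    (christoffel h 0 0 1 q = (G q * (pdi 1 E q / 2) - F q * (pdi 0 G q / 2))
        / (E q * G q - F q ^ 2) ∧
      christoffel h 1 0 1 q = (E q * (pdi 0 G q / 2) - F q * (pdi 1 E q / 2))
        / (E q * G q - F q ^ 2)) ∧
    (christoffel h 0 1 0 q = (G q * (pdi 1 E q / 2) - F q * (pdi 0 G q / 2))
        / (E q * G q - F q ^ 2) ∧
      christoffel h 1 1 0 q = (E q * (pdi 0 G q / 2) - F q * (pdi 1 E q / 2))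
        / (E q * G q - F q ^ 2)) ∧
    (christoffel h 0 1 1 q = (G q * (pdi 1 F q - pdi 0 G q / 2) - F q * (pdi 1 G q / 2))
        / (E q * G q - F q ^ 2) ∧
      christoffel h 1 1 1 q = (E q * (pdi 1 G q / 2) - F q * (pdi 1 F q - pdi 0 G q / 2))
        / (E q * G q - F q ^ 2)) := by
  obtain ⟨i₀₀, i₀₁, i₁₀, i₁₁⟩ := inv_entries (hh q hq)
  obtain ⟨a₀₀, a₀₁, a₁₀, a₁₁⟩ := pdi_entries hU hh hq 0
  obtain ⟨b₀₀, b₀₁, b₁₀, b₁₁⟩ := pdi_entries hU hh hq 1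
  simp only [christoffel, Fin.sum_univ_two, i₀₀, i₀₁, i₁₀, i₁₁, a₀₀, a₀₁, a₁₀, a₁₁,
    b₀₀, b₀₁, b₁₀, b₁₁]
  refine ⟨⟨?_, ?_⟩, ⟨?_, ?_⟩, ⟨?_, ?_⟩, ?_, ?_⟩ <;> ring

lemma gaussCurv_eq (hU : IsOpen U) (hh : ∀ p ∈ U, h p = !![E p, F p; F p, G p])
    (hE : ContDiffOn ℝ 2 E U) (hF : ContDiffOn ℝ 2 F U) (hG : ContDiffOn ℝ 2 G U)
    (hD : ∀ p ∈ U, E p * G p - F p ^ 2 ≠ 0) (hq : q ∈ U) :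
    gaussCurv h q = riemannLower E F G q / (E q * G q - F q ^ 2) := by
  have hDq := hD q hq
  have dE := hE.differentiableAt_of_isOpen hU two_ne_zero hq
  have dF := hF.differentiableAt_of_isOpen hU two_ne_zero hq
  have dG := hG.differentiableAt_of_isOpen hU two_ne_zero hq
  have d1 : ∀ {f : ℝ × ℝ → ℝ} (_ : ContDiffOn ℝ 2 f U) (i : Fin 2),
      DifferentiableAt ℝ (pdi i f) q := fun hf i =>
    (hf.pdi (m := 1) i hU le_rfl).differentiableAt_of_isOpen hU one_ne_zero hq
  have dE0 := d1 hE 0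
  have dE1 := d1 hE 1
  have dF0 := d1 hF 0
  have dF1 := d1 hF 1
  have dG0 := d1 hG 0
  have dG1 := d1 hG 1
  have hc := fun p (hp : p ∈ U) => christoffel_eq hU hh hp
  have dc : ∀ {c f : ℝ × ℝ → ℝ}, (∀ p ∈ U, c p = f p / (E p * G p - F p ^ 2)) →
      DifferentiableAt ℝ f q → DifferentiableAt ℝ c q := by
    intro c f hcf hf
    refine (hf.fun_mul (DifferentiableAt.fun_inv (h := fun p => E p * G p - F p ^ 2)
      (by fun_prop) hDq)).congr_of_eventuallyEq ?_
    simp only [← div_eq_mul_inv]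
    filter_upwards [hU.mem_nhds hq] with p hp using hcf p hp
  have d011 : DifferentiableAt ℝ (christoffel h 0 1 1) q :=
    dc (fun p hp => (hc p hp).2.2.2.1) (by fun_prop)
  have d111 : DifferentiableAt ℝ (christoffel h 1 1 1) q :=
    dc (fun p hp => (hc p hp).2.2.2.2) (by fun_prop)
  have d001 : DifferentiableAt ℝ (christoffel h 0 0 1) q :=
    dc (fun p hp => (hc p hp).2.1.1) (by fun_prop)
  have d101 : DifferentiableAt ℝ (christoffel h 1 0 1) q :=
    dc (fun p hp => (hc p hp).2.1.2) (by fun_prop)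
  have e₁ := pdi_congr (f₁ := fun p => E p * christoffel h 0 1 1 p + F p * christoffel h 1 1 1 p)
    (f₂ := fun p => pdi 1 F p - (1 / 2) * pdi 0 G p) 0 hU hq fun p hp => by
      have := hD p hp
      rw [(hc p hp).2.2.2.1, (hc p hp).2.2.2.2]
      field_simp
      ring
  have e₂ := pdi_congr (f₁ := fun p => E p * christoffel h 0 0 1 p + F p * christoffel h 1 0 1 p)
    (f₂ := fun p => (1 / 2) * pdi 1 E p) 1 hU hq fun p hp => by
      have := hD p hp
      rw [(hc p hp).2.1.1, (hc p hp).2.1.2]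
      field_simp
      ring
  rw [pdi_add 0 (dE.fun_mul d011) (dF.fun_mul d111), pdi_mul 0 dE d011, pdi_mul 0 dF d111,
    pdi_sub 0 dF1 (dG0.const_mul _), pdi_const_mul 0 _ dG0] at e₁
  rw [pdi_add 1 (dE.fun_mul d001) (dF.fun_mul d101), pdi_mul 1 dE d001, pdi_mul 1 dF d101,
    pdi_const_mul 1 _ dE1] at e₂
  have hdet : (h q).det = E q * G q - F q ^ 2 := by
    rw [hh q hq, Matrix.det_fin_two]
    simp [sq]
  have h00 : h q 0 0 = E q := by simp [hh q hq]
  have h01 : h q 0 1 = F q := by simp [hh q hq]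
  obtain ⟨⟨c000, c100⟩, ⟨c001, c101⟩, ⟨c010, c110⟩, c011, c111⟩ := hc q hq
  rw [gaussCurv, hdet]
  congr 1
  simp only [Fin.sum_univ_two, h00, h01]
  have key := congrArg₂ (· - ·) e₁ e₂
  simp only [c000, c100, c001, c101, c010, c110, c011, c111] at key ⊢
  unfold riemannLower
  generalize pdi 0 (christoffel h 0 1 1) q = x₁ at *
  generalize pdi 0 (christoffel h 1 1 1) q = x₂ at *
  generalize pdi 1 (christoffel h 0 0 1) q = x₃ at *
  generalize pdi 1 (christoffel h 1 0 1) q = x₄ at *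
  rw [← sub_eq_zero] at key ⊢
  rw [← key]
  field_simp
  ring

end Curvature

section Darboux

variable {E F G z : ℝ × ℝ → ℝ} {U : Set (ℝ × ℝ)} {q : ℝ × ℝ}

/-- The determinant of `g - dz²` equals `det g * (1 - |∇_g z|²)`. -/
lemma det_sub_eq_det_mul_gradSq {g : ℝ × ℝ → Matrix (Fin 2) (Fin 2) ℝ}
    (hg : g q = !![E q, F q; F q, G q]) (hD : E q * G q - F q ^ 2 ≠ 0) :
    (E q - pdi 0 z q * pdi 0 z q) * (G q - pdi 1 z q * pdi 1 z q)
        - (F q - pdi 0 z q * pdi 1 z q) ^ 2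
      = (E q * G q - F q ^ 2) * (1 - gradSq g z q) := by
  obtain ⟨i₀₀, i₀₁, i₁₀, i₁₁⟩ := inv_entries hg
  simp only [gradSq, Fin.sum_univ_two, i₀₀, i₀₁, i₁₀, i₁₁]
  field_simp
  ring

lemma gmod_eq {g : ℝ × ℝ → Matrix (Fin 2) (Fin 2) ℝ} (hg : g q = !![E q, F q; F q, G q]) :
    gmod g z q = !![E q - pdi 0 z q * pdi 0 z q, F q - pdi 0 z q * pdi 1 z q;
      F q - pdi 0 z q * pdi 1 z q, G q - pdi 1 z q * pdi 1 z q] := by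
  ext i j
  fin_cases i <;> fin_cases j <;> simp [gmod, hg, mul_comm]

/-- The Gauss equation for the curvature of `g - dz²`. -/
lemma riemannLower_sub_sq_mul_det {g : ℝ × ℝ → Matrix (Fin 2) (Fin 2) ℝ} (hU : IsOpen U)
    (hg : ∀ p ∈ U, g p = !![E p, F p; F p, G p])
    (hE : ContDiffOn ℝ 2 E U) (hF : ContDiffOn ℝ 2 F U) (hG : ContDiffOn ℝ 2 G U)
    (hz : ContDiffOn ℝ 3 z U) (hq : q ∈ U) (hD : E q * G q - F q ^ 2 ≠ 0)
    (hD' : (E q - pdi 0 z q * pdi 0 z q) * (G q - pdi 1 z q * pdi 1 z q)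
        - (F q - pdi 0 z q * pdi 1 z q) ^ 2 ≠ 0) :
    riemannLower (fun p => E p - pdi 0 z p * pdi 0 z p) (fun p => F p - pdi 0 z p * pdi 1 z p)
        (fun p => G p - pdi 1 z p * pdi 1 z p) q
        * ((E q - pdi 0 z q * pdi 0 z q) * (G q - pdi 1 z q * pdi 1 z q)
        - (F q - pdi 0 z q * pdi 1 z q) ^ 2)
      = riemannLower E F G q * ((E q - pdi 0 z q * pdi 0 z q) * (G q - pdi 1 z q * pdi 1 z q)
        - (F q - pdi 0 z q * pdi 1 z q) ^ 2)
        - (E q * G q - F q ^ 2)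
          * (covHess g z 0 0 q * covHess g z 1 1 q - covHess g z 0 1 q ^ 2) := by
  have hz0 : ContDiffOn ℝ 2 (pdi 0 z) U := hz.pdi (m := 2) 0 hU le_rfl
  have hz1 : ContDiffOn ℝ 2 (pdi 1 z) U := hz.pdi (m := 2) 1 hU le_rfl
  have hz2 : ContDiffOn ℝ 2 z U := hz.of_le (by norm_num)
  have dE := hE.differentiableAt_of_isOpen hU two_ne_zero hq
  have dF := hF.differentiableAt_of_isOpen hU two_ne_zero hq
  have dG := hG.differentiableAt_of_isOpen hU two_ne_zero hq
  have d0 := hz0.differentiableAt_of_isOpen hU two_ne_zero hq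
  have d1 := hz1.differentiableAt_of_isOpen hU two_ne_zero hq
  have s1 : pdi 1 (pdi 0 z) q = pdi 0 (pdi 1 z) q := pdi_comm hU hz2 hq
  have s2 : pdi 1 (pdi 1 (pdi 0 z)) q = pdi 0 (pdi 1 (pdi 1 z)) q := by
    rw [pdi_congr 1 hU hq fun p hp => pdi_comm hU hz2 hp, pdi_comm hU hz1 hq]
  have s3 : pdi 0 (pdi 1 (pdi 0 z)) q = pdi 0 (pdi 0 (pdi 1 z)) q :=
    pdi_congr 0 hU hq fun p hp => pdi_comm hU hz2 hp
  obtain ⟨⟨c000, c100⟩, ⟨c001, c101⟩, -, c011, c111⟩ := christoffel_eq hU hg hq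
  simp only [covHess, Fin.sum_univ_two, c000, c100, c001, c101, c011, c111]
  unfold riemannLower
  rw [pdi_pdi_sub 0 1 hU hF (hz0.mul hz1) hq, pdi_pdi_mul 0 1 hU hz0 hz1 hq,
    pdi_pdi_sub 0 0 hU hG (hz1.mul hz1) hq, pdi_pdi_mul 0 0 hU hz1 hz1 hq,
    pdi_pdi_sub 1 1 hU hE (hz0.mul hz0) hq, pdi_pdi_mul 1 1 hU hz0 hz0 hq]
  have e : ∀ i, pdi i (fun p => E p - pdi 0 z p * pdi 0 z p) q =
      pdi i E q - (pdi i (pdi 0 z) q * pdi 0 z q + pdi 0 z q * pdi i (pdi 0 z) q) := fun i => by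
    rw [pdi_sub i dE (d0.fun_mul d0), pdi_mul i d0 d0]
  have f : ∀ i, pdi i (fun p => F p - pdi 0 z p * pdi 1 z p) q =
      pdi i F q - (pdi i (pdi 0 z) q * pdi 1 z q + pdi 0 z q * pdi i (pdi 1 z) q) := fun i => by
    rw [pdi_sub i dF (d0.fun_mul d1), pdi_mul i d0 d1]
  have g' : ∀ i, pdi i (fun p => G p - pdi 1 z p * pdi 1 z p) q =
      pdi i G q - (pdi i (pdi 1 z) q * pdi 1 z q + pdi 1 z q * pdi i (pdi 1 z) q) := fun i => by
    rw [pdi_sub i dG (d1.fun_mul d1), pdi_mul i d1 d1]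
  simp only [e, f, g', s1, s2, s3]
  generalize pdi 0 (pdi 1 F) q = F01 at *
  generalize pdi 0 (pdi 0 G) q = G00 at *
  generalize pdi 1 (pdi 1 E) q = E11 at *
  generalize pdi 0 (pdi 0 (pdi 1 z)) q = z001 at *
  generalize pdi 0 (pdi 1 (pdi 1 z)) q = z011 at *
  generalize pdi 0 (pdi 0 z) q = z00 at *
  generalize pdi 0 (pdi 1 z) q = z01 at *
  generalize pdi 1 (pdi 1 z) q = z11 at *
  clear e f g' s1 s2 s3 c000 c100 c001 c101 c011 c111
  generalize hd' : (E q - pdi 0 z q * pdi 0 z q) * (G q - pdi 1 z q * pdi 1 z q)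
    - (F q - pdi 0 z q * pdi 1 z q) ^ 2 = d' at *
  generalize hd : E q * G q - F q ^ 2 = d at *
  field_simp
  rw [← hd', ← hd]
  ring

end Darboux

section Flat

variable {a b c P Q : ℝ × ℝ → ℝ} {U : Set (ℝ × ℝ)} {q : ℝ × ℝ}

/-- In terms of the orthonormal coframe `a dx + b dy`, `c dy` with connection form
`P dx + Q dy`, the curvature is the exterior derivative of the connection form. -/
lemma riemannLower_coframe (hU : IsOpen U) (ha : ContDiffOn ℝ 2 a U) (hb : ContDiffOn ℝ 2 b U)
    (hc : ContDiffOn ℝ 2 c U) (ha0 : a q ≠ 0) (hc0 : c q ≠ 0)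
    (hP : DifferentiableAt ℝ P q) (hQ : DifferentiableAt ℝ Q q)
    (hcP : ∀ p ∈ U, c p * P p = pdi 0 b p - pdi 1 a p)
    (haQ : ∀ p ∈ U, a p * Q p = pdi 0 c p + b p * P p) (hq : q ∈ U) :
    riemannLower (fun p => a p * a p) (fun p => a p * b p) (fun p => b p * b p + c p * c p) q
      = a q * c q * (pdi 1 P q - pdi 0 Q q) := by
  have da := ha.differentiableAt_of_isOpen hU two_ne_zero hq
  have db := hb.differentiableAt_of_isOpen hU two_ne_zero hq
  have dc := hc.differentiableAt_of_isOpen hU two_ne_zero hq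
  have d1 : ∀ {f : ℝ × ℝ → ℝ} (_ : ContDiffOn ℝ 2 f U) (i : Fin 2),
      DifferentiableAt ℝ (pdi i f) q := fun hf i =>
    (hf.pdi (m := 1) i hU le_rfl).differentiableAt_of_isOpen hU one_ne_zero hq
  have e₀ := pdi_congr 0 hU hq hcP
  have e₁ := pdi_congr 1 hU hq hcP
  have e₂ := pdi_congr 0 hU hq haQ
  rw [pdi_mul _ dc hP, pdi_sub _ (d1 hb 0) (d1 ha 1)] at e₀ e₁
  rw [pdi_mul _ da hQ, pdi_add _ (d1 hc 0) (db.fun_mul hP), pdi_mul _ db hP] at e₂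
  rw [pdi_comm hU hb hq] at e₁
  have e₃ := hcP q hq
  have e₄ := haQ q hq
  have s := pdi_comm hU ha hq
  unfold riemannLower
  rw [pdi_pdi_add 0 0 hU (hb.mul hb) (hc.mul hc) hq, pdi_pdi_mul 0 0 hU hb hb hq,
    pdi_pdi_mul 0 0 hU hc hc hq, pdi_pdi_mul 1 1 hU ha ha hq, pdi_pdi_mul 0 1 hU ha hb hq]
  simp only [pdi_add _ (db.fun_mul db) (dc.fun_mul dc), pdi_mul _ da da, pdi_mul _ da db,
    pdi_mul _ db db, pdi_mul _ dc dc]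
  have hP' : P q = (pdi 0 b q - pdi 1 a q) / c q := by field_simp; linarith
  have hQ' : Q q = (pdi 0 c q + b q * P q) / a q := by field_simp; linarith
  have hPy : pdi 1 P q = (pdi 0 (pdi 1 b) q - pdi 1 (pdi 1 a) q - pdi 1 c q * P q) / c q := by
    field_simp; linarith
  have hPx : pdi 0 P q = (pdi 0 (pdi 0 b) q - pdi 0 (pdi 1 a) q - pdi 0 c q * P q) / c q := by
    field_simp; linarith
  have hQx : pdi 0 Q q = (pdi 0 (pdi 0 c) q + (pdi 0 b q * P q + b q * pdi 0 P q)
      - pdi 0 a q * Q q) / a q := by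
    field_simp; linarith
  have hD : a q * a q * (b q * b q + c q * c q) - (a q * b q) ^ 2 = (a q * c q) ^ 2 := by ring
  rw [hD, hPy, hQx, hPx, hQ', hP']
  field_simp
  ring

lemma injOn_of_hasFDerivAt {u v : ℝ × ℝ → ℝ} {u₁ u₂ v₁ v₂ : ℝ × ℝ → ℝ} (hU : IsOpen U)
    (hq : q ∈ U)
    (hu : ∀ p ∈ U, HasFDerivAt u
      (u₁ p • ContinuousLinearMap.fst ℝ ℝ ℝ + u₂ p • ContinuousLinearMap.snd ℝ ℝ ℝ) p)
    (hv : ∀ p ∈ U, HasFDerivAt v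
      (v₁ p • ContinuousLinearMap.fst ℝ ℝ ℝ + v₂ p • ContinuousLinearMap.snd ℝ ℝ ℝ) p)
    (hu₁ : ContinuousAt u₁ q) (hu₂ : ContinuousAt u₂ q)
    (hv₁ : ContinuousAt v₁ q) (hv₂ : ContinuousAt v₂ q)
    (hdet : u₁ q * v₂ q - u₂ q * v₁ q ≠ 0) :
    ∃ V ⊆ U, IsOpen V ∧ q ∈ V ∧ InjOn (fun p => (u p, v p)) V := by
  have hs : HasStrictFDerivAt (fun p => (u p, v p))
      ((u₁ q • ContinuousLinearMap.fst ℝ ℝ ℝ + u₂ q • ContinuousLinearMap.snd ℝ ℝ ℝ).prod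
        (v₁ q • ContinuousLinearMap.fst ℝ ℝ ℝ + v₂ q • ContinuousLinearMap.snd ℝ ℝ ℝ)) q := by
    refine hasStrictFDerivAt_of_hasFDerivAt_of_continuousAt
      (f' := fun p => (u₁ p • ContinuousLinearMap.fst ℝ ℝ ℝ
        + u₂ p • ContinuousLinearMap.snd ℝ ℝ ℝ).prod
        (v₁ p • ContinuousLinearMap.fst ℝ ℝ ℝ + v₂ p • ContinuousLinearMap.snd ℝ ℝ ℝ)) ?_ ?_
    · filter_upwards [hU.mem_nhds hq] with p hp using (hu p hp).prodMk (hv p hp)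
    · exact (ContinuousLinearMap.prodₗᵢ ℝ (𝕜 := ℝ) (E := ℝ × ℝ) (F := ℝ)
        (G := ℝ)).continuous.continuousAt.comp (f := fun p =>
          (u₁ p • ContinuousLinearMap.fst ℝ ℝ ℝ + u₂ p • ContinuousLinearMap.snd ℝ ℝ ℝ,
          v₁ p • ContinuousLinearMap.fst ℝ ℝ ℝ + v₂ p • ContinuousLinearMap.snd ℝ ℝ ℝ)) (by fun_prop)
  set d := u₁ q * v₂ q - u₂ q * v₁ q with hd
  let e : (ℝ × ℝ) ≃L[ℝ] ℝ × ℝ := ContinuousLinearEquiv.equivOfInverse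
    ((u₁ q • ContinuousLinearMap.fst ℝ ℝ ℝ + u₂ q • ContinuousLinearMap.snd ℝ ℝ ℝ).prod
        (v₁ q • ContinuousLinearMap.fst ℝ ℝ ℝ + v₂ q • ContinuousLinearMap.snd ℝ ℝ ℝ))
    (((v₂ q / d) • ContinuousLinearMap.fst ℝ ℝ ℝ
        + (-u₂ q / d) • ContinuousLinearMap.snd ℝ ℝ ℝ).prod
      ((-v₁ q / d) • ContinuousLinearMap.fst ℝ ℝ ℝ
        + (u₁ q / d) • ContinuousLinearMap.snd ℝ ℝ ℝ))
    (fun x => by ext <;> simp <;> field_simp <;> rw [hd] <;> ring)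
    (fun x => by ext <;> simp <;> field_simp <;> rw [hd] <;> ring)
  have hs' : HasStrictFDerivAt (fun p => (u p, v p)) (e : ℝ × ℝ →L[ℝ] ℝ × ℝ) q := hs
  refine ⟨(hs'.toOpenPartialHomeomorph _).source ∩ U, inter_subset_right,
    (hs'.toOpenPartialHomeomorph _).open_source.inter hU,
    ⟨hs'.mem_toOpenPartialHomeomorph_source, hq⟩, ?_⟩
  have := (hs'.toOpenPartialHomeomorph _).injOn
  rw [hs'.toOpenPartialHomeomorph_coe] at this
  exact this.mono inter_subset_left

/-- A flat planar metric, given by an orthonormal coframe, has Euclidean coordinates near every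
point. -/
lemma exists_euclidean_coords_of_coframe (hU : IsOpen U)
    (ha : ContDiffOn ℝ 2 a U) (hb : ContDiffOn ℝ 2 b U)
    (hc : ContDiffOn ℝ 2 c U) (ha0 : ∀ p ∈ U, a p ≠ 0) (hc0 : ∀ p ∈ U, c p ≠ 0)
    (hflat : ∀ p ∈ U, riemannLower (fun p => a p * a p) (fun p => a p * b p)
      (fun p => b p * b p + c p * c p) p = 0) (hq : q ∈ U) :
    ∃ u v : ℝ × ℝ → ℝ, ∃ V ⊆ U, IsOpen V ∧ q ∈ V ∧
      (∀ p ∈ V, a p * a p = pdi 0 u p * pdi 0 u p + pdi 0 v p * pdi 0 v p ∧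
        a p * b p = pdi 0 u p * pdi 1 u p + pdi 0 v p * pdi 1 v p ∧
        b p * b p + c p * c p = pdi 1 u p * pdi 1 u p + pdi 1 v p * pdi 1 v p) ∧
      InjOn (fun p => (u p, v p)) V := by
  obtain ⟨r, hr, hrU⟩ := Metric.isOpen_iff.1 hU q hq
  set B := Metric.ball q r
  have hB : IsOpen B := Metric.isOpen_ball
  have hBc : Convex ℝ B := convex_ball q r
  have hqB : q ∈ B := Metric.mem_ball_self hr
  have dif : ∀ {f : ℝ × ℝ → ℝ} {n : ℕ}, ContDiffOn ℝ n f U → n ≠ 0 → DifferentiableOn ℝ f B :=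
    fun hf hn p hp => (hf.differentiableAt_of_isOpen hU hn (hrU hp)).differentiableWithinAt
  have da := dif ha two_ne_zero
  have db := dif hb two_ne_zero
  have dc := dif hc two_ne_zero
  have dpdi : ∀ {f : ℝ × ℝ → ℝ} (i : Fin 2), ContDiffOn ℝ 2 f U → DifferentiableOn ℝ (pdi i f) B :=
    fun i hf => dif (hf.pdi (m := 1) i hU le_rfl) one_ne_zero
  set P : ℝ × ℝ → ℝ := fun p => (pdi 0 b p - pdi 1 a p) / c p with hPdef
  set Q : ℝ × ℝ → ℝ := fun p => (pdi 0 c p + b p * P p) / a p with hQdef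
  have hP : DifferentiableOn ℝ P B := by
    simp only [hPdef, div_eq_mul_inv]
    exact ((dpdi 0 hb).sub (dpdi 1 ha)).mul (dc.fun_inv fun p hp => hc0 p (hrU hp))
  have hQ : DifferentiableOn ℝ Q B := by
    simp only [hQdef, div_eq_mul_inv]
    exact ((dpdi 0 hc).add (db.mul hP)).mul (da.fun_inv fun p hp => ha0 p (hrU hp))
  have hcP : ∀ p ∈ U, c p * P p = pdi 0 b p - pdi 1 a p := fun p hp => by
    have := hc0 p hp
    simp only [hPdef]
    field_simp
  have haQ : ∀ p ∈ U, a p * Q p = pdi 0 c p + b p * P p := fun p hp => by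
    have := ha0 p hp
    simp only [hQdef]
    field_simp
  obtain ⟨φ, hφ⟩ := exists_hasFDerivAt_of_pdi_eq hBc hB hP hQ fun p hp => by
    have := riemannLower_coframe hU ha hb hc (ha0 p (hrU hp)) (hc0 p (hrU hp))
      (hP.differentiableAt (hB.mem_nhds hp)) (hQ.differentiableAt (hB.mem_nhds hp)) hcP haQ (hrU hp)
    rw [hflat p (hrU hp), eq_comm, mul_eq_zero, mul_eq_zero] at this
    have := this.resolve_left (by simp [ha0 p (hrU hp), hc0 p (hrU hp)])
    linarith
  have dφ : DifferentiableOn ℝ φ B := fun p hp => (hφ p hp).differentiableAt.differentiableWithinAt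
  have trig : ∀ (i : Fin 2), ∀ p ∈ B, pdi i (fun x => Real.cos (φ x)) p =
      -Real.sin (φ p) * pdi i φ p ∧
      pdi i (fun x => Real.sin (φ x)) p = Real.cos (φ p) * pdi i φ p := fun i p hp => by
    have := (hφ p hp).differentiableAt
    simp only [pdi, this.hasFDerivAt.cos.fderiv, this.hasFDerivAt.sin.fderiv, smul_apply,
      smul_eq_mul, and_self]
  have at_ : ∀ {f : ℝ × ℝ → ℝ}, DifferentiableOn ℝ f B → ∀ p ∈ B, DifferentiableAt ℝ f p :=
    fun hf p hp => hf.differentiableAt (hB.mem_nhds hp)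
  have dcos : DifferentiableOn ℝ (fun x => Real.cos (φ x)) B := dφ.cos
  have dsin : DifferentiableOn ℝ (fun x => Real.sin (φ x)) B := dφ.sin
  obtain ⟨u, hu⟩ := exists_hasFDerivAt_of_pdi_eq hBc hB
    (P := fun p => Real.cos (φ p) * a p)
    (Q := fun p => Real.cos (φ p) * b p - Real.sin (φ p) * c p)
    (dcos.mul da) ((dcos.mul db).sub (dsin.mul dc)) fun p hp => by
      rw [pdi_mul 1 (at_ dcos p hp) (at_ da p hp),
        pdi_sub 0 ((at_ dcos p hp).fun_mul (at_ db p hp)) ((at_ dsin p hp).fun_mul (at_ dc p hp)),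
        pdi_mul 0 (at_ dcos p hp) (at_ db p hp), pdi_mul 0 (at_ dsin p hp) (at_ dc p hp),
        (trig 0 p hp).1, (trig 0 p hp).2, (trig 1 p hp).1, (hφ p hp).pdi_zero, (hφ p hp).pdi_one]
      linear_combination (-Real.sin (φ p)) * haQ p (hrU hp) + Real.cos (φ p) * hcP p (hrU hp)
  obtain ⟨v, hv⟩ := exists_hasFDerivAt_of_pdi_eq hBc hB
    (P := fun p => Real.sin (φ p) * a p)
    (Q := fun p => Real.sin (φ p) * b p + Real.cos (φ p) * c p)
    (dsin.mul da) ((dsin.mul db).add (dcos.mul dc)) fun p hp => by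
      rw [pdi_mul 1 (at_ dsin p hp) (at_ da p hp),
        pdi_add 0 ((at_ dsin p hp).fun_mul (at_ db p hp)) ((at_ dcos p hp).fun_mul (at_ dc p hp)),
        pdi_mul 0 (at_ dsin p hp) (at_ db p hp), pdi_mul 0 (at_ dcos p hp) (at_ dc p hp),
        (trig 0 p hp).1, (trig 0 p hp).2, (trig 1 p hp).2, (hφ p hp).pdi_zero, (hφ p hp).pdi_one]
      linear_combination Real.cos (φ p) * haQ p (hrU hp) + Real.sin (φ p) * hcP p (hrU hp)
  have ca := (at_ da q hqB).continuousAt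
  have cb := (at_ db q hqB).continuousAt
  have cc := (at_ dc q hqB).continuousAt
  have ccos := (at_ dcos q hqB).continuousAt
  have csin := (at_ dsin q hqB).continuousAt
  obtain ⟨V, hVB, hV, hqV, hinj⟩ := injOn_of_hasFDerivAt hB hqB hu hv (ccos.mul ca)
    ((ccos.mul cb).sub (csin.mul cc)) (csin.mul ca) ((csin.mul cb).add (ccos.mul cc)) (by
      have : Real.cos (φ q) * a q * (Real.sin (φ q) * b q + Real.cos (φ q) * c q)
          - (Real.cos (φ q) * b q - Real.sin (φ q) * c q) * (Real.sin (φ q) * a q)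
          = a q * c q := by
        linear_combination a q * c q * Real.sin_sq_add_cos_sq (φ q)
      rw [this]
      exact mul_ne_zero (ha0 q hq) (hc0 q hq))
  refine ⟨u, v, V, hVB.trans hrU, hV, hqV, fun p hp => ?_, hinj⟩
  rw [(hu p (hVB hp)).pdi_zero, (hu p (hVB hp)).pdi_one, (hv p (hVB hp)).pdi_zero,
    (hv p (hVB hp)).pdi_one]
  have hsc := Real.sin_sq_add_cos_sq (φ p)
  refine ⟨?_, ?_, ?_⟩
  · linear_combination -(a p * a p) * hsc
  · linear_combination -(a p * b p) * hsc
  · linear_combination -(b p * b p + c p * c p) * hsc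

lemma riemannLower_congr {E F G E' F' G' : ℝ × ℝ → ℝ} (hU : IsOpen U) (hq : q ∈ U)
    (hE : ∀ p ∈ U, E p = E' p) (hF : ∀ p ∈ U, F p = F' p) (hG : ∀ p ∈ U, G p = G' p) :
    riemannLower E F G q = riemannLower E' F' G' q := by
  have hE' := fun i p hp => pdi_congr (q := p) i hU hp hE
  have hF' := fun i p hp => pdi_congr (q := p) i hU hp hF
  have hG' := fun i p hp => pdi_congr (q := p) i hU hp hG
  simp only [riemannLower, hE q hq, hF q hq, hG q hq, hE' _ q hq, hF' _ q hq, hG' _ q hq,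
    pdi_congr _ hU hq (hE' 1), pdi_congr _ hU hq (hF' 1), pdi_congr _ hU hq (hG' 0)]

/-- A flat planar Riemannian metric has Euclidean coordinates near every point. -/
lemma exists_euclidean_coords {E F G : ℝ × ℝ → ℝ} (hU : IsOpen U)
    (hE : ContDiffOn ℝ 2 E U) (hF : ContDiffOn ℝ 2 F U) (hG : ContDiffOn ℝ 2 G U)
    (hE0 : ∀ p ∈ U, 0 < E p) (hD0 : ∀ p ∈ U, 0 < E p * G p - F p ^ 2)
    (hflat : ∀ p ∈ U, riemannLower E F G p = 0) (hq : q ∈ U) :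
    ∃ u v : ℝ × ℝ → ℝ, ∃ V ⊆ U, IsOpen V ∧ q ∈ V ∧
      (∀ p ∈ V, E p = pdi 0 u p * pdi 0 u p + pdi 0 v p * pdi 0 v p ∧
        F p = pdi 0 u p * pdi 1 u p + pdi 0 v p * pdi 1 v p ∧
        G p = pdi 1 u p * pdi 1 u p + pdi 1 v p * pdi 1 v p) ∧
      InjOn (fun p => (u p, v p)) V := by
  have ha : ContDiffOn ℝ 2 (fun p => √(E p)) U := hE.sqrt fun p hp => (hE0 p hp).ne'
  have ha0 : ∀ p ∈ U, √(E p) ≠ 0 := fun p hp => (Real.sqrt_pos.2 (hE0 p hp)).ne'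
  have hb : ContDiffOn ℝ 2 (fun p => F p / √(E p)) U := hF.div ha ha0
  have hc1 : ∀ p ∈ U, 0 < (E p * G p - F p ^ 2) / E p := fun p hp => div_pos (hD0 p hp) (hE0 p hp)
  have hc : ContDiffOn ℝ 2 (fun p => √((E p * G p - F p ^ 2) / E p)) U :=
    (((hE.mul hG).sub (hF.pow 2)).div hE fun p hp => (hE0 p hp).ne').sqrt fun p hp => (hc1 p hp).ne'
  have e₁ : ∀ p ∈ U, √(E p) * √(E p) = E p := fun p hp => Real.mul_self_sqrt (hE0 p hp).le
  have e₂ : ∀ p ∈ U, √(E p) * (F p / √(E p)) = F p := fun p hp => mul_div_cancel₀ _ (ha0 p hp)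
  have e₃ : ∀ p ∈ U, F p / √(E p) * (F p / √(E p))
      + √((E p * G p - F p ^ 2) / E p) * √((E p * G p - F p ^ 2) / E p) = G p := fun p hp => by
    have := (hE0 p hp).ne'
    rw [Real.mul_self_sqrt (hc1 p hp).le, div_mul_div_comm, e₁ p hp]
    field_simp
    ring
  obtain ⟨u, v, V, hVU, hV, hqV, huv, hinj⟩ := exists_euclidean_coords_of_coframe hU ha hb hc ha0
    (fun p hp => (Real.sqrt_pos.2 (hc1 p hp)).ne')
    (fun p hp => (riemannLower_congr hU hp e₁ e₂ e₃).trans (hflat p hp)) hq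
  refine ⟨u, v, V, hVU, hV, hqV, fun p hp => ?_, hinj⟩
  have := huv p hp
  rwa [e₁ p (hVU hp), e₂ p (hVU hp), e₃ p (hVU hp)] at this

end Flat

/-- The Darboux equation is equivalent to flatness of `g - dz²`, and a solution
of the Darboux equation with `|∇z(0)| = 0` yields a local isometric embedding
`(u, v, z)` of `(Ω, g)` into `ℝ³`. -/
theorem stmt_18 (g : ℝ × ℝ → Matrix (Fin 2) (Fin 2) ℝ) (z : ℝ × ℝ → ℝ)
    (U : Set (ℝ × ℝ)) (hU : IsOpen U) (h0 : ((0:ℝ), (0:ℝ)) ∈ U)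
    (hsc : SimplyConnectedSpace U)
    (hg : ∀ i j : Fin 2, ContDiffOn ℝ 2 (fun q => g q i j) U)
    (hgpos : ∀ q ∈ U, (g q).PosDef)
    (hz : ContDiffOn ℝ 3 z U)
    (hgrad : ∀ q ∈ U, 1 - gradSq g z q > 0) :
    ((∀ q ∈ U, gaussCurv (gmod g z) q = 0) ↔
      (∀ q ∈ U, covHess g z 0 0 q * covHess g z 1 1 q - (covHess g z 0 1 q) ^ 2
        = gaussCurv g q * (g q).det * (1 - gradSq g z q))) ∧
    ((∀ q ∈ U, covHess g z 0 0 q * covHess g z 1 1 q - (covHess g z 0 1 q) ^ 2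
        = gaussCurv g q * (g q).det * (1 - gradSq g z q)) →
      pdi 0 z (0, 0) = 0 → pdi 1 z (0, 0) = 0 →
      ∃ (u v : ℝ × ℝ → ℝ) (V : Set (ℝ × ℝ)), V ⊆ U ∧ IsOpen V ∧ ((0:ℝ), (0:ℝ)) ∈ V ∧
        (∀ q ∈ V, ∀ i j : Fin 2,
          g q i j - pdi i z q * pdi j z q = pdi i u q * pdi j u q + pdi i v q * pdi j v q) ∧
        Set.InjOn (fun q => (u q, v q, z q)) V) := by
  have hsymm : ∀ q ∈ U, g q 1 0 = g q 0 1 := fun q hq => by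
    simpa using (hgpos q hq).isHermitian.apply 0 1
  have hgE : ∀ p ∈ U, g p = !![g p 0 0, g p 0 1; g p 0 1, g p 1 1] := fun p hp => by
    conv_lhs => rw [Matrix.eta_fin_two (g p), hsymm p hp]
  have hdet : ∀ p ∈ U, (g p).det = g p 0 0 * g p 1 1 - g p 0 1 ^ 2 := fun p hp => by
    rw [Matrix.det_fin_two, hsymm p hp, sq]
  have hD : ∀ p ∈ U, 0 < g p 0 0 * g p 1 1 - g p 0 1 ^ 2 := fun p hp => by
    rw [← hdet p hp]
    exact (hgpos p hp).det_pos
  have hE0 : ∀ p ∈ U, 0 < g p 0 0 := fun p hp => (hgpos p hp).diag_pos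
  have hDdet := fun p hp => det_sub_eq_det_mul_gradSq (E := fun p => g p 0 0)
    (F := fun p => g p 0 1) (G := fun p => g p 1 1) (q := p) (z := z) (hgE p hp) (hD p hp).ne'
  have hD' : ∀ p ∈ U, 0 < (g p 0 0 - pdi 0 z p * pdi 0 z p) * (g p 1 1 - pdi 1 z p * pdi 1 z p)
      - (g p 0 1 - pdi 0 z p * pdi 1 z p) ^ 2 := fun p hp => by
    rw [hDdet p hp]
    exact mul_pos (hD p hp) (hgrad p hp)
  have hE0' : ∀ p ∈ U, 0 < g p 0 0 - pdi 0 z p * pdi 0 z p := fun p hp => by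
    refine pos_of_mul_pos_left (b := g p 0 0 * g p 1 1 - g p 0 1 ^ 2) ?_ (hD p hp).le
    have h₁ := mul_pos (hE0 p hp) (hD' p hp)
    have h₂ := sq_nonneg (g p 0 1 * pdi 0 z p - g p 0 0 * pdi 1 z p)
    linear_combination h₁ + h₂
  have hz0 : ContDiffOn ℝ 2 (pdi 0 z) U := hz.pdi (m := 2) 0 hU le_rfl
  have hz1 : ContDiffOn ℝ 2 (pdi 1 z) U := hz.pdi (m := 2) 1 hU le_rfl
  have hR := fun q hq => riemannLower_sub_sq_mul_det (z := z) (q := q) hU hgE (hg 0 0) (hg 0 1)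
    (hg 1 1) hz hq (hD q hq).ne' (hD' q hq).ne'
  have hK := fun q hq => gaussCurv_eq (q := q) hU hgE (hg 0 0) (hg 0 1) (hg 1 1)
    (fun p hp => (hD p hp).ne') hq
  have hK' := fun q hq => gaussCurv_eq (q := q) (E := fun p => g p 0 0 - pdi 0 z p * pdi 0 z p)
    (F := fun p => g p 0 1 - pdi 0 z p * pdi 1 z p) (G := fun p => g p 1 1 - pdi 1 z p * pdi 1 z p)
    hU (fun p hp => gmod_eq (E := fun p => g p 0 0) (F := fun p => g p 0 1)
      (G := fun p => g p 1 1) (hgE p hp))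
    ((hg 0 0).sub (hz0.mul hz0)) ((hg 0 1).sub (hz0.mul hz1)) ((hg 1 1).sub (hz1.mul hz1))
    (fun p hp => (hD' p hp).ne') hq
  have hiff : ∀ q ∈ U, riemannLower (fun p => g p 0 0 - pdi 0 z p * pdi 0 z p)
      (fun p => g p 0 1 - pdi 0 z p * pdi 1 z p) (fun p => g p 1 1 - pdi 1 z p * pdi 1 z p) q = 0 ↔
      covHess g z 0 0 q * covHess g z 1 1 q - (covHess g z 0 1 q) ^ 2
        = gaussCurv g q * (g q).det * (1 - gradSq g z q) := fun q hq => by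
    have h₁ := hR q hq
    rw [hDdet q hq] at h₁
    rw [hK q hq, hdet q hq, div_mul_cancel₀ _ (hD q hq).ne']
    have h₂ : (g q 0 0 * g q 1 1 - g q 0 1 ^ 2) ≠ 0 := (hD q hq).ne'
    have h₃ := (hgrad q hq).ne'
    constructor
    · intro h
      rw [h, zero_mul] at h₁
      refine mul_left_cancel₀ h₂ ?_
      linear_combination h₁
    · intro h
      rw [h] at h₁
      refine (mul_eq_zero.1 (h₁.trans ?_)).resolve_right (mul_ne_zero h₂ h₃)
      ring
  refine ⟨forall₂_congr fun q hq => ?_, fun hdarboux _ _ => ?_⟩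
  · rw [hK' q hq, div_eq_zero_iff, or_iff_left (hD' q hq).ne']
    exact hiff q hq
  · obtain ⟨u, v, V, hVU, hV, h0V, huv, hinj⟩ := exists_euclidean_coords hU
      ((hg 0 0).sub (hz0.mul hz0)) ((hg 0 1).sub (hz0.mul hz1)) ((hg 1 1).sub (hz1.mul hz1))
      hE0' hD' (fun q hq => (hiff q hq).2 (hdarboux q hq)) h0
    refine ⟨u, v, V, hVU, hV, h0V, fun q hq i j => ?_, fun x hx y hy hxy => ?_⟩
    · obtain ⟨h₁, h₂, h₃⟩ := huv q hq
      fin_cases i <;> fin_cases j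
      · exact h₁
      · exact h₂
      · simp only [Fin.mk_one, Fin.zero_eta, hsymm q (hVU hq)]
        linear_combination h₂
      · exact h₃
    · simp only [Prod.mk.injEq] at hxy
      exact hinj hx hy (Prod.ext hxy.1 hxy.2.1)
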